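/- There exist a real polynomial u and a real constant c > 0 such that the even Schwartz function f(x) = u(x²) e^{−x²/2} satisfies: (i) f(x) ≤ 0 for all x ∈ ℝ; (ii) f̂(√(λ − 1/4)) ≥ c for all λ ∈ [1.67, 2.2]; (iii) f̂(√(λ − 1/4)) ≥ 0 for all λ ≥ 2.2; (iv) (1/c) · ( 2 ∫₀^∞ ξ f̂(ξ) tanh(πξ) dξ − (1/√(2π)) ∫_ℝ f(x) cosh(x/2) dx ) < 6. -/

import Mathlib

open Real MeasureTheory

/-- The even function `x ↦ u(x²) e^{-x²/2}` associated to a real polynomial `u`. -/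
noncomputable def gaussPoly (u : Polynomial ℝ) (x : ℝ) : ℝ :=
  u.eval (x ^ 2) * Real.exp (-x ^ 2 / 2)

/-- The Fourier transform `f̂(ξ) = (1/√(2π)) ∫_ℝ f(x) e^{-iξx} dx` of an even real-valued
function, written in its real form `(1/√(2π)) ∫_ℝ f(x) cos(ξ x) dx`. -/
noncomputable def evenFT (f : ℝ → ℝ) (ξ : ℝ) : ℝ :=
  (1 / Real.sqrt (2 * π)) * ∫ x : ℝ, f x * Real.cos (ξ * x)

/-- Polynomial multiples of `x ↦ e^{-x²/2 + zx}` are integrable. -/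
lemma integrable_pow_mul_cexp (n : ℕ) (z : ℂ) :
    Integrable fun x : ℝ => (x : ℂ) ^ n * Complex.exp (-(x : ℂ) ^ 2 / 2 + z * x) := by
  have key (w : ℂ) : Integrable fun x : ℝ => Complex.exp (-(x : ℂ) ^ 2 / 2 + w * x) := by
    have h := integrable_cexp_quadratic (b := 1 / 2) (by norm_num) w 0
    refine h.congr (.of_forall fun x => ?_)
    simp only
    congr 1
    ring
  refine Integrable.mono' (((key (z + 1)).norm.add (key (z - 1)).norm).const_mul (n.factorial : ℝ))
    (by fun_prop) (.of_forall fun x => ?_)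
  have h1 : |x| ^ n ≤ n.factorial * (Real.exp x + Real.exp (-x)) := by
    have h := Real.pow_div_factorial_le_exp |x| (abs_nonneg x) n
    rw [div_le_iff₀ (by positivity), mul_comm] at h
    refine h.trans ?_
    gcongr
    rcases abs_cases x with ⟨hx, -⟩ | ⟨hx, -⟩ <;> rw [hx] <;>
      linarith [Real.exp_pos x, Real.exp_pos (-x)]
  have h2 : ∀ ε : ℝ, ‖Complex.exp (-(x : ℂ) ^ 2 / 2 + (z + ε) * x)‖
      = ‖Complex.exp (-(x : ℂ) ^ 2 / 2 + z * x)‖ * Real.exp (ε * x) := by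
    intro ε
    rw [add_mul, ← add_assoc, Complex.exp_add, norm_mul]
    congr 1
    rw [← Complex.ofReal_mul, Complex.norm_exp_ofReal]
  have h3 := h2 1
  have h4 := h2 (-1)
  push_cast [← sub_eq_add_neg] at h3 h4
  simp only [one_mul, neg_mul] at h3 h4
  simp only [Pi.add_apply, norm_mul, norm_pow, Complex.norm_real, Real.norm_eq_abs, h3, h4]
  calc _ ≤ (n.factorial * (Real.exp x + Real.exp (-x)))
        * ‖Complex.exp (-(x : ℂ) ^ 2 / 2 + z * x)‖ := by gcongr
    _ = _ := by ring

/-- The polynomials `Hₙ` with `∫ xⁿ e^{-x²/2 + zx} dx = √(2π) Hₙ(z) e^{z²/2}`. -/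
noncomputable def gaussMoment (z : ℂ) : ℕ → ℂ
  | 0 => 1
  | 1 => z
  | n + 2 => z * gaussMoment z (n + 1) + (n + 1) * gaussMoment z n

lemma integral_pow_mul_cexp (z : ℂ) (n : ℕ) :
    ∫ x : ℝ, (x : ℂ) ^ n * Complex.exp (-(x : ℂ) ^ 2 / 2 + z * x)
      = gaussMoment z n * (Real.sqrt (2 * π) * Complex.exp (z ^ 2 / 2)) := by
  have hderiv (n : ℕ) (x : ℝ) :
      HasDerivAt (fun x : ℝ => (x : ℂ) ^ n * Complex.exp (-(x : ℂ) ^ 2 / 2 + z * x))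
        ((n * (x : ℂ) ^ (n - 1) + z * (x : ℂ) ^ n - (x : ℂ) ^ (n + 1))
          * Complex.exp (-(x : ℂ) ^ 2 / 2 + z * x)) x := by
    have h1 : HasDerivAt (fun w : ℂ => -w ^ 2 / 2 + z * w) (-x + z) (x : ℂ) := by
      have := (((hasDerivAt_pow 2 (x : ℂ)).neg).div_const 2).add
        ((hasDerivAt_id (x : ℂ)).const_mul z)
      exact this.congr_deriv (by simp; ring)
    exact ((hasDerivAt_pow n (x : ℂ)).mul h1.cexp).comp_ofReal.congr_deriv (by
      rcases n with _ | n
      · simp; ring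
      · simp only [Nat.add_sub_cancel]; ring)
  have hrec (n : ℕ) :
      ∫ x : ℝ, (x : ℂ) ^ (n + 1) * Complex.exp (-(x : ℂ) ^ 2 / 2 + z * x)
        = n * (∫ x : ℝ, (x : ℂ) ^ (n - 1) * Complex.exp (-(x : ℂ) ^ 2 / 2 + z * x))
          + z * ∫ x : ℝ, (x : ℂ) ^ n * Complex.exp (-(x : ℂ) ^ 2 / 2 + z * x) := by
    have i1 := (integrable_pow_mul_cexp (n - 1) z).const_mul (n : ℂ)
    have i2 := (integrable_pow_mul_cexp n z).const_mul z
    have i3 := integrable_pow_mul_cexp (n + 1) z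
    have h := integral_eq_zero_of_hasDerivAt_of_integrable (hderiv n)
      (((i1.add i2).sub i3).congr (.of_forall fun x => by
        simp only [Pi.add_apply, Pi.sub_apply]; ring)) (integrable_pow_mul_cexp n z)
    rw [← integral_const_mul, ← integral_const_mul, ← integral_add i1 i2, eq_comm, ← sub_eq_zero,
      ← integral_sub' (f := fun x : ℝ => _ + _) (i1.add i2) i3, ← h]
    congr 1 with x
    simp only [Pi.sub_apply]
    ring
  have h0 : ∫ x : ℝ, Complex.exp (-(x : ℂ) ^ 2 / 2 + z * x)
      = Real.sqrt (2 * π) * Complex.exp (z ^ 2 / 2) := by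
    have h := integral_cexp_quadratic (b := -(1 / 2)) (by norm_num) z 0
    have hs : ((π : ℂ) / -(-(1 / 2))) ^ (1 / 2 : ℂ) = (Real.sqrt (2 * π) : ℂ) := by
      rw [Real.sqrt_eq_rpow, Complex.ofReal_cpow (by positivity)]
      push_cast
      congr 1
      ring
    rw [hs] at h
    convert h using 2
    · ext x
      congr 1
      ring
    · congr 1
      ring
  induction n using Nat.twoStepInduction with
  | zero => simpa [gaussMoment] using h0
  | one => simpa [gaussMoment, h0] using hrec 0
  | more n ih1 ih2 =>
    rw [hrec (n + 1), Nat.add_sub_cancel, ih1, ih2, gaussMoment]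
    push_cast
    ring

lemma gaussMoment_add_four (z : ℂ) (n : ℕ) :
    gaussMoment z (n + 4) = (z ^ 2 + 2 * n + 5) * gaussMoment z (n + 2)
      - (n + 2) * (n + 1) * gaussMoment z n := by
  rw [gaussMoment, gaussMoment, gaussMoment]
  push_cast
  ring

/-- The exponential transform of `x ↦ (∑ aₖ x^{2k}) e^{-x²/2}`. -/
lemma integral_sum_mul_cexp (N : ℕ) (a : ℕ → ℝ) (z : ℂ) :
    ∫ x : ℝ, (∑ k ∈ Finset.range N, (a k : ℂ) * (x : ℂ) ^ (2 * k))
        * Complex.exp (-(x : ℂ) ^ 2 / 2 + z * x)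
      = (∑ k ∈ Finset.range N, (a k : ℂ) * gaussMoment z (2 * k))
        * (Real.sqrt (2 * π) * Complex.exp (z ^ 2 / 2)) := by
  simp only [Finset.sum_mul, mul_assoc]
  rw [integral_finsetSum _ fun k _ => (integrable_pow_mul_cexp (2 * k) z).const_mul (a k : ℂ)]
  exact Finset.sum_congr rfl fun k _ => by rw [integral_const_mul, integral_pow_mul_cexp]

lemma integrable_sum_mul_cexp (N : ℕ) (a : ℕ → ℝ) (z : ℂ) :
    Integrable fun x : ℝ => (∑ k ∈ Finset.range N, (a k : ℂ) * (x : ℂ) ^ (2 * k))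
        * Complex.exp (-(x : ℂ) ^ 2 / 2 + z * x) := by
  simp only [Finset.sum_mul, mul_assoc]
  exact integrable_finsetSum _ fun k _ => (integrable_pow_mul_cexp (2 * k) z).const_mul (a k : ℂ)

lemma evenFT_gaussPoly {N : ℕ} {a : ℕ → ℝ} {u : Polynomial ℝ}
    (hu : ∀ y, u.eval y = ∑ k ∈ Finset.range N, a k * y ^ k) {ξ w : ℝ}
    (hw : ∑ k ∈ Finset.range N, (a k : ℂ) * gaussMoment (ξ * Complex.I) (2 * k) = w) :
    evenFT (gaussPoly u) ξ = w * Real.exp (-ξ ^ 2 / 2) := by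
  have h := integral_sum_mul_cexp N a (ξ * Complex.I)
  have hre : ∀ x : ℝ, gaussPoly u x * Real.cos (ξ * x)
      = RCLike.re ((∑ k ∈ Finset.range N, (a k : ℂ) * (x : ℂ) ^ (2 * k))
        * Complex.exp (-(x : ℂ) ^ 2 / 2 + ξ * Complex.I * x)) := by
    intro x
    have h1 : Complex.exp (-(x : ℂ) ^ 2 / 2 + ξ * Complex.I * x)
        = (Real.exp (-x ^ 2 / 2) : ℂ) * Complex.exp ((ξ * x : ℝ) * Complex.I) := by
      rw [Complex.exp_add]
      push_cast
      congr 2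
      ring
    have h2 : (∑ k ∈ Finset.range N, (a k : ℂ) * (x : ℂ) ^ (2 * k))
        = ((u.eval (x ^ 2) : ℝ) : ℂ) := by
      rw [hu]
      push_cast
      simp only [pow_mul]
    rw [h1, h2, ← mul_assoc, ← Complex.ofReal_mul, RCLike.re_eq_complex_re, Complex.re_ofReal_mul,
      Complex.exp_ofReal_mul_I_re, gaussPoly]
  rw [evenFT]
  simp only [hre]
  rw [integral_re (integrable_sum_mul_cexp N a _), h, hw]
  have h3 : Complex.exp ((ξ * Complex.I) ^ 2 / 2) = (Real.exp (-ξ ^ 2 / 2) : ℂ) := by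
    push_cast
    congr 1
    rw [mul_pow, Complex.I_sq]
    ring
  rw [h3, ← Complex.ofReal_mul, ← Complex.ofReal_mul, RCLike.re_eq_complex_re, Complex.ofReal_re]
  have : Real.sqrt (2 * π) ≠ 0 := by positivity
  field_simp

lemma integral_gaussPoly_mul_cosh {N : ℕ} {a : ℕ → ℝ} {u : Polynomial ℝ}
    (hu : ∀ y, u.eval y = ∑ k ∈ Finset.range N, a k * y ^ k) {t w : ℝ}
    (hw : ∑ k ∈ Finset.range N, (a k : ℂ) * gaussMoment t (2 * k) = w)
    (hw' : ∑ k ∈ Finset.range N, (a k : ℂ) * gaussMoment (-t) (2 * k) = w) :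
    (1 / Real.sqrt (2 * π)) * ∫ x : ℝ, gaussPoly u x * Real.cosh (t * x)
      = w * Real.exp (t ^ 2 / 2) := by
  have h := integral_sum_mul_cexp N a t
  have h' := integral_sum_mul_cexp N a (-t)
  have hc : ∀ x : ℝ, ((gaussPoly u x * Real.cosh (t * x) : ℝ) : ℂ)
      = (1 / 2) * ((∑ k ∈ Finset.range N, (a k : ℂ) * (x : ℂ) ^ (2 * k))
          * Complex.exp (-(x : ℂ) ^ 2 / 2 + t * x)
        + (∑ k ∈ Finset.range N, (a k : ℂ) * (x : ℂ) ^ (2 * k))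
          * Complex.exp (-(x : ℂ) ^ 2 / 2 + (-t) * x)) := by
    intro x
    rw [gaussPoly, hu, Complex.exp_add, Complex.exp_add]
    push_cast
    rw [Complex.cosh]
    simp only [pow_mul, neg_mul]
    ring
  have key : ((∫ x : ℝ, gaussPoly u x * Real.cosh (t * x) : ℝ) : ℂ)
      = ((w * (Real.sqrt (2 * π) * Real.exp (t ^ 2 / 2)) : ℝ) : ℂ) := by
    rw [← integral_complex_ofReal]
    simp only [hc]
    rw [integral_const_mul, integral_add (integrable_sum_mul_cexp N a _)
      (integrable_sum_mul_cexp N a _), h, h', hw, hw']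
    push_cast
    rw [neg_sq]
    ring
  rw [Complex.ofReal_inj.1 key]
  have : Real.sqrt (2 * π) ≠ 0 := by positivity
  field_simp

lemma integrableOn_pow_mul_gauss (n : ℕ) :
    IntegrableOn (fun x : ℝ => x ^ n * Real.exp (-x ^ 2 / 2)) (Set.Ioi 0) := by
  have h := integrableOn_rpow_mul_exp_neg_mul_rpow (p := 2) (s := n) (b := 1 / 2)
    (by have : (0 : ℝ) ≤ n := n.cast_nonneg; linarith) (by norm_num) (by norm_num)
  refine h.congr_fun (fun x _ => ?_) measurableSet_Ioi
  simp only [Real.rpow_natCast, Real.rpow_ofNat]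
  ring_nf

lemma integral_odd_pow_mul_gauss (k : ℕ) :
    ∫ x in Set.Ioi (0 : ℝ), x ^ (2 * k + 1) * Real.exp (-x ^ 2 / 2) = 2 ^ k * k.factorial := by
  have h := integral_rpow_mul_exp_neg_mul_rpow (p := 2) (q := (2 * k + 1 : ℕ)) (b := 1 / 2)
    (by norm_num) (by have : (0 : ℝ) ≤ (2 * k + 1 : ℕ) := Nat.cast_nonneg _; linarith)
    (by norm_num)
  simp only [Real.rpow_natCast, Real.rpow_ofNat] at h
  have e : (((2 * k + 1 : ℕ) : ℝ) + 1) / 2 = (k : ℝ) + 1 := by push_cast; ring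
  rw [neg_div, e, Real.Gamma_nat_eq_factorial] at h
  calc _ = ∫ x in Set.Ioi (0 : ℝ), x ^ (2 * k + 1) * Real.exp (-(1 / 2) * x ^ 2) := by
        congr 1 with x
        ring_nf
    _ = _ := by
        rw [h, one_div, Real.inv_rpow (by norm_num), Real.rpow_neg (by norm_num), inv_inv,
          ← Nat.cast_succ, Real.rpow_natCast, pow_succ]
        ring

lemma integrableOn_pow_mul_exp (n : ℕ) {a : ℝ} (ha : 0 < a) :
    IntegrableOn (fun x : ℝ => x ^ n * Real.exp (-(a * x))) (Set.Ioi 0) := by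
  have h := integrableOn_rpow_mul_exp_neg_mul_rpow (p := 1) (s := n) (b := a)
    (by have : (0 : ℝ) ≤ n := n.cast_nonneg; linarith) (by norm_num) ha
  refine h.congr_fun (fun x _ => ?_) measurableSet_Ioi
  simp only [Real.rpow_natCast, Real.rpow_one, neg_mul]

lemma integral_pow_mul_exp (n : ℕ) {a : ℝ} (ha : 0 < a) :
    ∫ x in Set.Ioi (0 : ℝ), x ^ n * Real.exp (-(a * x)) = n.factorial / a ^ (n + 1) := by
  have h := Real.integral_rpow_mul_exp_neg_mul_Ioi (a := n + 1) (r := a) (by positivity) ha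
  simp only [add_sub_cancel_right, Real.rpow_natCast] at h
  rw [h, Real.Gamma_nat_eq_factorial, ← Nat.cast_add_one, Real.rpow_natCast, div_pow, one_pow]
  ring

lemma one_sub_tanh_le {x : ℝ} (hx : 0 ≤ x) :
    1 - Real.tanh x ≤ 2 * Real.exp (-(2 * x)) - Real.exp (-(4 * x)) := by
  set t := Real.exp (-(2 * x)) with ht
  have ht0 : 0 < t := Real.exp_pos _
  have ht1 : t ≤ 1 := Real.exp_le_one_iff.2 (by linarith)
  have h4 : Real.exp (-(4 * x)) = t ^ 2 := by
    rw [ht, ← Real.exp_nat_mul]; congr 1; push_cast; ring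
  have h2 : Real.exp (-x) = t * Real.exp x := by
    rw [ht, ← Real.exp_add]; congr 1; ring
  have hth : Real.tanh x = (1 - t) / (1 + t) := by
    rw [Real.tanh_eq, h2]
    have := Real.exp_pos x
    field_simp
  rw [h4, hth, sub_le_iff_le_add', ← sub_le_iff_le_add, le_div_iff₀ (by positivity)]
  nlinarith [mul_nonneg (sq_nonneg t) (sub_nonneg.2 ht1)]

/-- The coefficients of the polynomial `u` of the test function. -/
noncomputable def testCoeff : ℕ → ℝ
  | 0 => -11875824
  | 1 => -152067946392
  | 2 => -33533144208
  | 3 => -8282509860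
  | 4 => 840779472
  | 5 => -323597158
  | 6 => 42304796
  | 7 => -3490773
  | 8 => 153995
  | 9 => -2500
  | _ => 0

/-- The polynomial `u` of the test function. -/
noncomputable def testPoly : Polynomial ℝ :=
  ∑ k ∈ Finset.range 10, Polynomial.C (testCoeff k) * Polynomial.X ^ k

/-- The coefficients of `dualPoly`. -/
noncomputable def dualCoeff : ℕ → ℝ
  | 0 => -400398475050
  | 1 => 843501431115
  | 2 => -224192388573
  | 3 => 20021057919
  | 4 => -3417472113
  | 5 => 1002867541
  | 6 => -130692847
  | 7 => 7961373
  | 8 => -228505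
  | 9 => 2500
  | _ => 0

/-- The polynomial `v` such that `v(ξ²) e^{-ξ²/2}` is the transform of `u(x²) e^{-x²/2}`. -/
def dualPoly (s : ℝ) : ℝ :=
  (s - 7) ^ 2 * (s - 15) ^ 2 * (s - 27) ^ 2 * (125 * s - 69) * (20 * s ^ 2 + 143 * s + 722)

lemma dualPoly_eq_sum (s : ℝ) : dualPoly s = ∑ k ∈ Finset.range 10, dualCoeff k * s ^ k := by
  simp only [Finset.sum_range_succ, Finset.sum_range_zero, dualCoeff, dualPoly]
  ring

lemma eval_testPoly (y : ℝ) :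
    testPoly.eval y = ∑ k ∈ Finset.range 10, testCoeff k * y ^ k := by
  simp [testPoly, Polynomial.eval_finsetSum]

lemma sum_testCoeff_mul_gaussMoment {z : ℂ} {s : ℝ} (hz : z ^ 2 = -s) :
    ∑ k ∈ Finset.range 10, (testCoeff k : ℂ) * gaussMoment z (2 * k) = dualPoly s := by
  have h0 : gaussMoment z 0 = 1 := rfl
  have h2 : gaussMoment z 2 = 1 - s := by
    simp only [gaussMoment]
    push_cast
    linear_combination hz
  have h4 : gaussMoment z 4 =
      3 - 6 * s + s ^ 2 := by
    rw [gaussMoment_add_four z 0, h2, h0, hz]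
    push_cast
    ring
  have h6 : gaussMoment z 6 =
      15 - 45 * s + 15 * s ^ 2 - s ^ 3 := by
    rw [gaussMoment_add_four z 2, h4, h2, hz]
    push_cast
    ring
  have h8 : gaussMoment z 8 =
      105 - 420 * s + 210 * s ^ 2 - 28 * s ^ 3 + s ^ 4 := by
    rw [gaussMoment_add_four z 4, h6, h4, hz]
    push_cast
    ring
  have h10 : gaussMoment z 10 =
      945 - 4725 * s + 3150 * s ^ 2 - 630 * s ^ 3 + 45 * s ^ 4 - s ^ 5 := by
    rw [gaussMoment_add_four z 6, h8, h6, hz]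
    push_cast
    ring
  have h12 : gaussMoment z 12 =
      10395 - 62370 * s + 51975 * s ^ 2 - 13860 * s ^ 3 + 1485 * s ^ 4 - 66 * s ^ 5 + s ^ 6 := by
    rw [gaussMoment_add_four z 8, h10, h8, hz]
    push_cast
    ring
  have h14 : gaussMoment z 14 =
      135135 - 945945 * s + 945945 * s ^ 2 - 315315 * s ^ 3 + 45045 * s ^ 4 - 3003 * s ^ 5 + 91 *
      s ^ 6 - s ^ 7 := by
    rw [gaussMoment_add_four z 10, h12, h10, hz]
    push_cast
    ring
  have h16 : gaussMoment z 16 =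
      2027025 - 16216200 * s + 18918900 * s ^ 2 - 7567560 * s ^ 3 + 1351350 * s ^ 4 - 120120 * s ^
      5 + 5460 * s ^ 6 - 120 * s ^ 7 + s ^ 8 := by
    rw [gaussMoment_add_four z 12, h14, h12, hz]
    push_cast
    ring
  have h18 : gaussMoment z 18 =
      34459425 - 310134825 * s + 413513100 * s ^ 2 - 192972780 * s ^ 3 + 41351310 * s ^ 4 -
      4594590 * s ^ 5 + 278460 * s ^ 6 - 9180 * s ^ 7 + 153 * s ^ 8 - s ^ 9 := by
    rw [gaussMoment_add_four z 14, h16, h14, hz]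
    push_cast
    ring
  simp only [Finset.sum_range_succ, Finset.sum_range_zero, testCoeff, dualPoly, Nat.reduceMul,
    mul_zero, h0, h2, h4, h6, h8, h10, h12, h14, h16, h18]
  push_cast
  ring

lemma testPoly_eval_nonpos {y : ℝ} (hy : 0 ≤ y) : testPoly.eval y ≤ 0 := by
  have h1 : 0 ≤ 4111896736953 / 10000 * (y - 251 / 10) ^ 2 + (-106985659932775953 / 1000000 + 1616983934006883 / 200000 * y) := by
    nlinarith [sq_nonneg (y - 15)]
  have h2 : 0 ≤ 485299 - 28495 * y + 2500 * y ^ 2 := by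
    nlinarith [sq_nonneg (y - 5)]
  have h3 : 0 ≤ y * ((y - 251 / 10) ^ 2 * (y * (146314966929 / 2000 + 916162113 / 50 * y + 37395 / 4 * y ^ 2
      + y ^ 3 * (485299 - 28495 * y + 2500 * y ^ 2)))
      + (4111896736953 / 10000 * (y - 251 / 10) ^ 2 + (-106985659932775953 / 1000000 + 1616983934006883 / 200000 * y))) := by
    positivity
  rw [eval_testPoly]
  simp only [Finset.sum_range_succ, Finset.sum_range_zero, testCoeff]
  linarith

lemma dualPoly_nonneg {s : ℝ} (hs : 69 / 125 ≤ s) : 0 ≤ dualPoly s := by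
  have h1 : 0 ≤ 125 * s - 69 := by linarith
  have h2 : 0 ≤ s := by linarith
  unfold dualPoly
  positivity

lemma le_dualPoly_mul_exp {s : ℝ} (h1 : 71 / 50 ≤ s) (h2 : s ≤ 39 / 20) :
    193440000000 ≤ dualPoly s * Real.exp (-s / 2) := by
  have he := Real.exp_bound' (x := s / 2) (by linarith) (by linarith) (n := 5) (by norm_num)
  simp only [Finset.sum_range_succ, Finset.sum_range_zero, Nat.factorial] at he
  norm_num at he
  have ha : 0 ≤ s - 71 / 50 := by linarith
  have hb : 0 ≤ 39 / 20 - s := by linarith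
  have hp : 0 ≤
      75472366059060128867712000 / 3299763591802133 * (39 / 20 - s) ^ 9 +
      58075050563979949140789632000 / 3299763591802133 * (s - 71 / 50) ^ 1 * (39 / 20 - s) ^ 8 +
      403522575046465404517220800000 / 3299763591802133 * (s - 71 / 50) ^ 2 * (39 / 20 - s) ^ 7 +
      1205833913662502110307482400000 / 3299763591802133 * (s - 71 / 50) ^ 3 * (39 / 20 - s) ^ 6 +
      2003687341688275735711236000000 / 3299763591802133 * (s - 71 / 50) ^ 4 * (39 / 20 - s) ^ 5 +
      1998479573559690269974375000000 / 3299763591802133 * (s - 71 / 50) ^ 5 * (39 / 20 - s) ^ 4 +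
      1196294761470305830089762500000 / 3299763591802133 * (s - 71 / 50) ^ 6 * (39 / 20 - s) ^ 3 +
      397961285522067840227343750000 / 3299763591802133 * (s - 71 / 50) ^ 7 * (39 / 20 - s) ^ 2 +
      56786481073918128837070312500 / 3299763591802133 * (s - 71 / 50) ^ 8 * (39 / 20 - s) ^ 1 +
      16808345033398613671875000 / 3299763591802133 * (s - 71 / 50) ^ 9 := by
    positivity
  have hle : 193440000000 * Real.exp (s / 2) ≤ dualPoly s := by
    unfold dualPoly
    linarith
  rwa [neg_div, Real.exp_neg, ← div_eq_mul_inv, le_div_iff₀ (Real.exp_pos _)]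

lemma neg_dualPoly_mul_exp_le {s : ℝ} (h1 : 0 ≤ s) (h2 : s ≤ 69 / 125) :
    -(dualPoly s * Real.exp (-s / 2)) ≤ 400398475050 * (1 - 5 / 4 * s) ^ 2 := by
  have he : Real.exp (-s / 2) ≤ 1 - s / 2 + s ^ 2 / 8 := by
    have h := Real.sum_le_exp_of_nonneg (x := s / 2) (by linarith) 4
    simp only [Finset.sum_range_succ, Finset.sum_range_zero, Nat.factorial] at h
    norm_num at h
    rw [neg_div, Real.exp_neg]
    refine inv_le_of_inv_le₀ (by nlinarith [sq_nonneg (s - 2)]) (le_trans ?_ h)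
    rw [inv_le_iff_one_le_mul₀ (by nlinarith [sq_nonneg (s - 2)])]
    nlinarith [pow_nonneg h1 3, pow_nonneg h1 4, pow_nonneg h1 5]
  have hb : 0 ≤ 69 / 125 - s := by linarith
  have hv : 0 ≤ -dualPoly s := by
    have h3 : 0 ≤ 69 - 125 * s := by linarith
    have : 0 ≤ (s - 7) ^ 2 * (s - 15) ^ 2 * (s - 27) ^ 2 * (69 - 125 * s)
      * (20 * s ^ 2 + 143 * s + 722) := by positivity
    unfold dualPoly
    linarith
  have hp : 0 ≤
      54556443355977535247802734375 / 3355547408305569 * s ^ 1 * (69 / 125 - s) ^ 10 +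
      35707634781442582607269287109375 / 241599413398000968 * s ^ 2 * (69 / 125 - s) ^ 9 +
      75631945205350339412689208984375 / 120799706699000484 * s ^ 3 * (69 / 125 - s) ^ 8 +
      395362631263452998638153076171875 / 241599413398000968 * s ^ 4 * (69 / 125 - s) ^ 7 +
      176685478845051677211761474609375 / 60399853349500242 * s ^ 5 * (69 / 125 - s) ^ 6 +
      449659615410653869115264892578125 / 120799706699000484 * s ^ 6 * (69 / 125 - s) ^ 5 +
      409478132381299569837895263671875 / 120799706699000484 * s ^ 7 * (69 / 125 - s) ^ 4 +
      130620786665525365715094103515625 / 60399853349500242 * s ^ 8 * (69 / 125 - s) ^ 3 +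
      55428432623447311540843460734375 / 60399853349500242 * s ^ 9 * (69 / 125 - s) ^ 2 +
      56143048838078634993369391463125 / 241599413398000968 * s ^ 10 * (69 / 125 - s) ^ 1 +
      79158362932503223419189453125 / 2982708807382728 * s ^ 11 := by
    positivity
  have hm := mul_le_mul_of_nonneg_left he hv
  have hq : -dualPoly s * (1 - s / 2 + s ^ 2 / 8) ≤ 400398475050 * (1 - 5 / 4 * s) ^ 2 := by
    unfold dualPoly
    linarith
  linarith

lemma evenFT_testPoly (ξ : ℝ) :
    evenFT (gaussPoly testPoly) ξ = dualPoly (ξ ^ 2) * Real.exp (-ξ ^ 2 / 2) :=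
  evenFT_gaussPoly eval_testPoly (sum_testCoeff_mul_gaussMoment (by
    rw [mul_pow, Complex.I_sq]; push_cast; ring))

lemma integral_testPoly_mul_cosh :
    (1 / Real.sqrt (2 * π)) * ∫ x : ℝ, gaussPoly testPoly x * Real.cosh (x / 2)
      = dualPoly (-1 / 4) * Real.exp (1 / 8) := by
  have h := integral_gaussPoly_mul_cosh (t := 1 / 2) eval_testPoly
    (sum_testCoeff_mul_gaussMoment (s := -1 / 4) (by push_cast; norm_num))
    (sum_testCoeff_mul_gaussMoment (by push_cast; norm_num))
  convert h using 3
  · ext x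
    congr 2
    ring
  · norm_num

lemma mul_evenFT_mul_tanh_le {ξ : ℝ} (hξ : 0 ≤ ξ) :
    ξ * evenFT (gaussPoly testPoly) ξ * Real.tanh (π * ξ)
      ≤ ξ * (dualPoly (ξ ^ 2) * Real.exp (-ξ ^ 2 / 2))
        + ξ * (400398475050 * (1 - 5 / 4 * ξ ^ 2) ^ 2)
          * (2 * Real.exp (-(2 * π * ξ)) - Real.exp (-(4 * π * ξ))) := by
  have hx : 0 ≤ π * ξ := by positivity
  have ht := one_sub_tanh_le hx
  have ht1 := (Real.tanh_lt_one (π * ξ)).le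
  rw [← mul_assoc 2, ← mul_assoc 4] at ht
  rw [evenFT_testPoly]
  set F := dualPoly (ξ ^ 2) * Real.exp (-ξ ^ 2 / 2) with hF
  set E := 2 * Real.exp (-(2 * π * ξ)) - Real.exp (-(4 * π * ξ))
  have hQ : 0 ≤ 400398475050 * (1 - 5 / 4 * ξ ^ 2) ^ 2 := by positivity
  suffices h : F * (Real.tanh (π * ξ) - 1) ≤ 400398475050 * (1 - 5 / 4 * ξ ^ 2) ^ 2 * E by
    nlinarith [mul_le_mul_of_nonneg_left h hξ]
  rcases le_total (ξ ^ 2) (69 / 125) with hs | hs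
  · have h := neg_dualPoly_mul_exp_le (sq_nonneg ξ) hs
    calc F * (Real.tanh (π * ξ) - 1) = -F * (1 - Real.tanh (π * ξ)) := by ring
      _ ≤ 400398475050 * (1 - 5 / 4 * ξ ^ 2) ^ 2 * (1 - Real.tanh (π * ξ)) :=
        mul_le_mul_of_nonneg_right h (by linarith)
      _ ≤ _ := mul_le_mul_of_nonneg_left ht hQ
  · have h : 0 ≤ F := mul_nonneg (dualPoly_nonneg hs) (Real.exp_pos _).le
    exact (mul_nonpos_of_nonneg_of_nonpos h (by linarith)).trans (mul_nonneg hQ (by linarith))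

lemma mul_dualPoly_mul_exp (ξ : ℝ) :
    ξ * (dualPoly (ξ ^ 2) * Real.exp (-ξ ^ 2 / 2))
      = ∑ k ∈ Finset.range 10, dualCoeff k * (ξ ^ (2 * k + 1) * Real.exp (-ξ ^ 2 / 2)) := by
  rw [dualPoly_eq_sum, Finset.sum_mul, Finset.mul_sum]
  exact Finset.sum_congr rfl fun k _ => by ring

lemma integrableOn_mul_dualPoly :
    IntegrableOn (fun ξ => ξ * (dualPoly (ξ ^ 2) * Real.exp (-ξ ^ 2 / 2))) (Set.Ioi 0) := by
  simp only [mul_dualPoly_mul_exp]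
  exact integrable_finsetSum _ fun k _ => (integrableOn_pow_mul_gauss (2 * k + 1)).const_mul _

lemma integral_mul_dualPoly :
    ∫ ξ in Set.Ioi (0 : ℝ), ξ * (dualPoly (ξ ^ 2) * Real.exp (-ξ ^ 2 / 2))
      = 212368755156 := by
  simp only [mul_dualPoly_mul_exp]
  rw [integral_finsetSum _ fun k _ => (integrableOn_pow_mul_gauss (2 * k + 1)).const_mul _]
  simp only [integral_const_mul, integral_odd_pow_mul_gauss, Finset.sum_range_succ,
    Finset.sum_range_zero, dualCoeff, Nat.factorial]
  norm_num

lemma integrableOn_sq_mul_exp {a : ℝ} (ha : 0 < a) :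
    IntegrableOn (fun x : ℝ => x * (1 - 5 / 4 * x ^ 2) ^ 2 * Real.exp (-(a * x))) (Set.Ioi 0) := by
  refine (((integrableOn_pow_mul_exp 1 ha).add ((integrableOn_pow_mul_exp 3 ha).const_mul
    (-5 / 2))).add ((integrableOn_pow_mul_exp 5 ha).const_mul (25 / 16))).congr
    (.of_forall fun x => ?_)
  simp only [Pi.add_apply]
  ring

lemma integral_sq_mul_exp {a : ℝ} (ha : 0 < a) :
    ∫ x in Set.Ioi (0 : ℝ), x * (1 - 5 / 4 * x ^ 2) ^ 2 * Real.exp (-(a * x))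
      = 1 / a ^ 2 - 15 / a ^ 4 + 375 / 2 / a ^ 6 := by
  have i1 := integrableOn_pow_mul_exp 1 ha
  have i3 := (integrableOn_pow_mul_exp 3 ha).const_mul (-5 / 2)
  have i5 := (integrableOn_pow_mul_exp 5 ha).const_mul (25 / 16)
  calc _ = ∫ x in Set.Ioi (0 : ℝ), x ^ 1 * Real.exp (-(a * x))
        + -5 / 2 * (x ^ 3 * Real.exp (-(a * x))) + 25 / 16 * (x ^ 5 * Real.exp (-(a * x))) := by
        congr 1 with x
        ring
    _ = _ := by
        refine (integral_add (i1.add i3) i5).trans ?_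
        rw [integral_add' i1 i3, integral_const_mul, integral_const_mul,
          integral_pow_mul_exp 1 ha, integral_pow_mul_exp 3 ha, integral_pow_mul_exp 5 ha]
        norm_num [Nat.factorial]
        ring

lemma integrableOn_mul_evenFT_mul_tanh :
    IntegrableOn (fun ξ => ξ * evenFT (gaussPoly testPoly) ξ * Real.tanh (π * ξ))
      (Set.Ioi 0) := by
  simp only [evenFT_testPoly]
  refine integrableOn_mul_dualPoly.mul_bdd (c := 1) ?_
    (.of_forall fun ξ => (Real.abs_tanh_lt_one _).le)
  refine Measurable.aestronglyMeasurable ?_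
  simp only [Real.tanh_eq_sinh_div_cosh]
  fun_prop

lemma integral_mul_evenFT_mul_tanh_le :
    ∫ ξ in Set.Ioi (0 : ℝ), ξ * evenFT (gaussPoly testPoly) ξ * Real.tanh (π * ξ)
      ≤ 212368755156 + 400398475050 *
        (2 * (1 / (2 * π) ^ 2 - 15 / (2 * π) ^ 4 + 375 / 2 / (2 * π) ^ 6)
          - (1 / (4 * π) ^ 2 - 15 / (4 * π) ^ 4 + 375 / 2 / (4 * π) ^ 6)) := by
  have i2 := (integrableOn_sq_mul_exp (a := 2 * π) (by positivity)).const_mul 2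
  have i4 := integrableOn_sq_mul_exp (a := 4 * π) (by positivity)
  have i24 := (i2.sub i4).const_mul 400398475050
  have hle := setIntegral_mono_on integrableOn_mul_evenFT_mul_tanh
    (integrableOn_mul_dualPoly.add i24) measurableSet_Ioi fun ξ hξ =>
      (mul_evenFT_mul_tanh_le (le_of_lt hξ)).trans_eq (by
        simp only [Pi.add_apply, Pi.sub_apply]; ring)
  refine hle.trans_eq ?_
  rw [integral_add' integrableOn_mul_dualPoly i24, integral_const_mul, integral_sub' i2 i4,
    integral_const_mul, integral_sq_mul_exp (by positivity), integral_sq_mul_exp (by positivity),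
    integral_mul_dualPoly]

/-- A bound for the error term in `integral_mul_evenFT_mul_tanh_le`. -/
lemma error_integral_le :
    2 * (1 / (2 * π) ^ 2 - 15 / (2 * π) ^ 4 + 375 / 2 / (2 * π) ^ 6)
      - (1 / (4 * π) ^ 2 - 15 / (4 * π) ^ 4 + 375 / 2 / (4 * π) ^ 6) ≤ 319 / 10000 := by
  have hpi := Real.pi_gt_d4
  have hpi' := Real.pi_lt_d4
  obtain ⟨p, hp⟩ : ∃ p, p = 1 / (2 * π) ^ 2 := ⟨_, rfl⟩
  have h1 : p ≤ 25332 / 1000000 := by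
    rw [hp, div_le_iff₀ (by positivity)]
    nlinarith
  have h0 : 25330 / 1000000 ≤ p := by
    rw [hp, le_div_iff₀ (by positivity)]
    nlinarith
  have e : 2 * (1 / (2 * π) ^ 2 - 15 / (2 * π) ^ 4 + 375 / 2 / (2 * π) ^ 6)
      - (1 / (4 * π) ^ 2 - 15 / (4 * π) ^ 4 + 375 / 2 / (4 * π) ^ 6)
      = 7 / 4 * p - 465 / 16 * p ^ 2 + 47625 / 128 * p ^ 3 := by
    rw [hp]
    field_simp
    ring
  rw [e]
  have h2 : (25330 / 1000000) ^ 2 ≤ p ^ 2 := by gcongr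
  have h3 : p ^ 3 ≤ (25332 / 1000000) ^ 3 := by gcongr
  linarith

theorem stmt_6 :
    ∃ (u : Polynomial ℝ) (c : ℝ), 0 < c ∧
      (let f : ℝ → ℝ := gaussPoly u
      let fhat : ℝ → ℝ := evenFT f
      (∀ x : ℝ, f x ≤ 0) ∧
      (∀ lam : ℝ, lam ∈ Set.Icc (1.67 : ℝ) 2.2 → fhat (Real.sqrt (lam - 1 / 4)) ≥ c) ∧
      (∀ lam : ℝ, (2.2 : ℝ) ≤ lam → fhat (Real.sqrt (lam - 1 / 4)) ≥ 0) ∧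
      (1 / c) *
          (2 * (∫ ξ in Set.Ioi (0 : ℝ), ξ * fhat ξ * Real.tanh (π * ξ))
            - (1 / Real.sqrt (2 * π)) * ∫ x : ℝ, f x * Real.cosh (x / 2)) < 6) := by
  refine ⟨testPoly, 193440000000, by norm_num, fun x => ?_, fun lam hlam => ?_,
    fun lam hlam => ?_, ?_⟩
  · exact mul_nonpos_of_nonpos_of_nonneg (testPoly_eval_nonpos (sq_nonneg x)) (Real.exp_pos _).le
  · have h1 := hlam.1
    have h2 := hlam.2
    norm_num at h1 h2
    rw [evenFT_testPoly, Real.sq_sqrt (by linarith)]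
    exact le_dualPoly_mul_exp (by linarith) (by linarith)
  · norm_num at hlam
    rw [evenFT_testPoly, Real.sq_sqrt (by linarith)]
    exact mul_nonneg (dualPoly_nonneg (by linarith)) (Real.exp_pos _).le
  · rw [integral_testPoly_mul_cosh, one_div_mul_eq_div, div_lt_iff₀ (by norm_num)]
    have hI := integral_mul_evenFT_mul_tanh_le
    have hE := error_integral_le
    have he := Real.exp_bound' (x := 1 / 8) (by norm_num) (by norm_num) (n := 3) (by norm_num)
    simp only [Finset.sum_range_succ, Finset.sum_range_zero, Nat.factorial] at he
    norm_num [dualPoly] at he ⊢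
    linarith
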